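/- Raising relation in the second variable index x₂: for every real q with 0 < q < 1, every integer N ≥ 1, all nonzero real numbers θ, φ, all integers n₁, n₂ ≥ 0 with n₁+n₂ ≤ N-1, and all integers x₁, x₂ ≥ 0 with x₁+x₂ ≤ N-1, one has K_{n₁,n₂}(x₁,x₂+1; q^{1/2}θ, φ; N) = q^{-1}(1-q^{n₁}) K_{n₁-1,n₂}(x₁,x₂; θ,φ; N-1) + q^{-n₁-1}(1-φ^{-2}q^{n₂})(1-q^{n₂}) K_{n₁,n₂-1}(x₁,x₂; θ,φ; N-1) + q^{-(n₁+n₂)} K_{n₁,n₂}(x₁,x₂; θ,φ; N-1), where by convention K with a negative degree index is 0. -/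

import Mathlib

open Finset

/-- The q-Pochhammer symbol `(a;q)_n = ∏_{k=0}^{n-1} (1 - a q^k)`. -/
noncomputable def qPoch (q a : ℝ) (n : ℕ) : ℝ := ∏ k ∈ Finset.range n, (1 - a * q ^ k)

/-- The quantum q-Krawtchouk polynomial `k_n(x;p,N;q)`, defined for all integers `x, N`. -/
noncomputable def qKraw (q : ℝ) (n : ℕ) (x N : ℤ) (p : ℝ) : ℝ :=
  (-1 : ℝ) ^ n * q ^ (n * (n - 1) / 2) *
    ∑ k ∈ Finset.range (n + 1),
      qPoch q (q ^ (-(n : ℤ))) k * qPoch q (q ^ (-x)) k *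
        qPoch q (q ^ ((k : ℤ) - N)) (n - k) / qPoch q q k * (p * q ^ (n + 1)) ^ k

/-- The bivariate quantum q-Krawtchouk polynomial of Gasper and Rahman,
`K_{n₁,n₂}(x₁,x₂;θ,φ;N) = k_{n₁}(x₁;θ^{-2},x₁+x₂;q) k_{n₂}(x₁+x₂-n₁;φ^{-2},N-n₁;q)`,
with the convention that it vanishes when a degree index is negative. -/
noncomputable def Kq (q : ℝ) (n₁ n₂ x₁ x₂ : ℤ) (θ φ : ℝ) (N : ℤ) : ℝ :=
  if 0 ≤ n₁ ∧ 0 ≤ n₂ then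
    qKraw q n₁.toNat x₁ (x₁ + x₂) (θ ^ 2)⁻¹ *
      qKraw q n₂.toNat (x₁ + x₂ - n₁) (N - n₁) (φ ^ 2)⁻¹
  else 0

/-- The q-trinomial coefficient `[N; x₁, x₂]_q`. -/
noncomputable def qTrinom (q : ℝ) (N x₁ x₂ : ℕ) : ℝ :=
  qPoch q q N / (qPoch q q x₁ * qPoch q q x₂ * qPoch q q (N - x₁ - x₂))

/-- The orthogonality weight `Δ^{(N)}_{x₁,x₂}(θ,φ)`. -/
noncomputable def Δw (q : ℝ) (N x₁ x₂ : ℕ) (θ φ : ℝ) : ℝ :=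
  (-1 : ℝ) ^ (N - x₁) * (θ ^ 2 * q⁻¹) ^ (x₁ + x₂) * q ^ (x₁ * (x₁ - 1) / 2) *
    qTrinom q N x₁ x₂ * qPoch q ((θ ^ 2)⁻¹ * q) x₂ * qPoch q ((φ ^ 2)⁻¹ * q) (N - x₁ - x₂) *
    φ ^ (2 * N) * q ^ (-((N : ℤ) * (N + 1) / 2))

/-- The normalization constant `H^{(N)}_{n₁,n₂}(θ,φ)`. -/
noncomputable def Hn (q : ℝ) (N n₁ n₂ : ℕ) (θ φ : ℝ) : ℝ :=
  (-1 : ℝ) ^ (n₁ + n₂) * qPoch q (q * (θ ^ 2)⁻¹) n₁ * qPoch q (q * (φ ^ 2)⁻¹) n₂ *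
    φ ^ (2 * n₁) * (qPoch q q N / qPoch q q (N - n₁ - n₂)) ^ 2 * (qTrinom q N n₁ n₂)⁻¹ *
    q ^ (3 * ((n₁ : ℤ) * (n₁ - 1)) / 2 + 3 * ((n₂ : ℤ) * (n₂ - 1)) / 2 +
          (n₁ : ℤ) * n₂ - (N : ℤ) * (n₁ + n₂) - 2 * n₁ - n₂)

/-- The dual weight `Δ̃^{(N)}_{n₁,n₂}(θ,φ)`. -/
noncomputable def Δdual (q : ℝ) (N n₁ n₂ : ℕ) (θ φ : ℝ) : ℝ :=
  (-1 : ℝ) ^ (n₁ + n₂) * q ^ (-((n₁ : ℤ) * (n₁ - 1)) - (n₂ : ℤ) * (n₂ - 1)) *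
    φ ^ (-(2 * (n₁ : ℤ))) * (qPoch q q (N - n₁ - n₂) / qPoch q q N) ^ 2 * qTrinom q N n₁ n₂ *
    q ^ ((N : ℤ) * (n₁ + n₂) + 2 * n₁ + n₂ - (n₁ : ℤ) * n₂ -
          (n₁ : ℤ) * (n₁ - 1) / 2 - (n₂ : ℤ) * (n₂ - 1) / 2) /
    (qPoch q (q * (θ ^ 2)⁻¹) n₁ * qPoch q (q * (φ ^ 2)⁻¹) n₂)

theorem qPoch_succ (q a : ℝ) (n : ℕ) : qPoch q a (n + 1) = qPoch q a n * (1 - a * q ^ n) :=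
  Finset.prod_range_succ _ n

theorem qPoch_succ_left (q a : ℝ) (n : ℕ) :
    qPoch q a (n + 1) = (1 - a) * qPoch q (a * q) n := by
  unfold qPoch
  rw [Finset.prod_range_succ', mul_comm]
  simp [pow_succ', mul_assoc]

theorem qPoch_self_ne_zero {q : ℝ} (hq0 : 0 < q) (hq1 : q < 1) (n : ℕ) : qPoch q q n ≠ 0 := by
  refine Finset.prod_ne_zero_iff.2 fun k _ => ?_
  rw [← pow_succ']
  exact (sub_pos.2 (pow_lt_one₀ hq0.le hq1 k.succ_ne_zero)).ne'

/-- The coefficient of `(q^{-x};q)_k p^k` in `k_n(x;p,N;q)`. -/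
noncomputable def qKrawCoeff (q : ℝ) (n k : ℕ) (N : ℤ) : ℝ :=
  (-1 : ℝ) ^ n * q ^ (n * (n - 1) / 2) *
    (qPoch q (q ^ (-(n : ℤ))) k * qPoch q (q ^ ((k : ℤ) - N)) (n - k) / qPoch q q k *
      (q ^ (n + 1)) ^ k)

theorem qKraw_eq_sum (q : ℝ) (n : ℕ) (x N : ℤ) (p : ℝ) :
    qKraw q n x N p =
      ∑ k ∈ Finset.range (n + 1), qKrawCoeff q n k N * (qPoch q (q ^ (-x)) k * p ^ k) := by
  unfold qKraw qKrawCoeff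
  rw [Finset.mul_sum]
  refine Finset.sum_congr rfl fun k _ => ?_
  rw [mul_pow]
  ring

theorem qKrawCoeff_succ_self {q : ℝ} (hq : q ≠ 0) (n : ℕ) (N : ℤ) :
    qKrawCoeff q n (n + 1) N = 0 := by
  have h : qPoch q (q ^ (-(n : ℤ))) (n + 1) = 0 := by
    rw [qPoch_succ, zpow_neg, zpow_natCast, inv_mul_cancel₀ (pow_ne_zero n hq)]
    simp
  rw [qKrawCoeff, h]
  ring

theorem pow_triangle_succ (q : ℝ) (n : ℕ) :
    q ^ ((n + 1) * (n + 1 - 1) / 2) = q ^ (n * (n - 1) / 2) * q ^ n := by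
  rw [Nat.triangle_succ, pow_add]

theorem zpow_neg_succ_mul {q : ℝ} (hq : q ≠ 0) (n : ℕ) :
    q ^ (-((n + 1 : ℕ) : ℤ)) * q = q ^ (-(n : ℤ)) := by
  rw [← zpow_add_one₀ hq]
  congr 1
  push_cast
  ring

/-- Contiguity of the coefficients in the degree and in `N`. -/
theorem qKrawCoeff_contiguous {q : ℝ} (hq : q ≠ 0) {n k : ℕ} (hk : k ≤ n + 1) (M : ℤ) :
    qKrawCoeff q (n + 1) k (M + 1) =
      q ^ k * (q⁻¹ * (1 - q ^ (n + 1)) * qKrawCoeff q n k M +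
        q ^ (-((n + 1 : ℕ) : ℤ)) * qKrawCoeff q (n + 1) k M) := by
  rcases hk.eq_or_lt with rfl | hk
  · rw [qKrawCoeff_succ_self hq, zpow_neg, zpow_natCast]
    simp [qKrawCoeff, qPoch, hq]
  obtain ⟨m, rfl⟩ := Nat.exists_eq_add_of_le (Nat.lt_succ_iff.1 hk)
  have e1 : k + m + 1 - k = m + 1 := by omega
  have e2 : k + m - k = m := by omega
  have hP := qPoch_succ q (q ^ (-((k + m + 1 : ℕ) : ℤ))) k
  rw [qPoch_succ_left, zpow_neg_succ_mul hq] at hP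
  have hc : q ^ ((k : ℤ) - (M + 1)) * q = q ^ ((k : ℤ) - M) := by
    rw [← zpow_add_one₀ hq]
    congr 1
    ring
  unfold qKrawCoeff
  rw [e1, e2, pow_triangle_succ, qPoch_succ_left q (q ^ ((k : ℤ) - (M + 1))), hc,
    qPoch_succ q (q ^ ((k : ℤ) - M)), ← hc]
  have hb : q ^ (-((k + m + 1 : ℕ) : ℤ)) * q ^ (k + m + 1) = 1 := by
    rw [zpow_neg, zpow_natCast, inv_mul_cancel₀ (pow_ne_zero _ hq)]
  generalize q ^ ((k : ℤ) - (M + 1)) = c at *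
  generalize q ^ (-((k + m + 1 : ℕ) : ℤ)) = b at *
  generalize qPoch q (q ^ (-((k + m : ℕ) : ℤ))) k = P at *
  generalize qPoch q b k = Q at *
  have hP' : (1 - q ^ (k + m + 1)) * P = -(q ^ (k + m + 1) * (Q * (1 - b * q ^ k))) := by
    linear_combination (-q ^ (k + m + 1)) * hP - P * hb
  have hP'' : q⁻¹ * ((1 - q ^ (k + m + 1)) * P) = -(q ^ (k + m) * (Q * (1 - b * q ^ k))) := by
    rw [hP', pow_succ]
    field_simp
  rw [show (q ^ (k + m + 1 + 1)) ^ k = (q ^ (k + m + 1)) ^ k * q ^ k by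
    rw [pow_succ, mul_pow]]
  generalize (q ^ (k + m + 1)) ^ k = w at *
  generalize qPoch q (c * q) m = R at *
  generalize q ^ ((k + m) * (k + m - 1) / 2) = t at *
  simp only [div_eq_mul_inv]
  generalize (qPoch q q k)⁻¹ = s at *
  generalize q⁻¹ = r at *
  rw [pow_succ, pow_add] at *
  linear_combination (- q ^ k * (-1) ^ k * (-1) ^ m * t * R * s * w) * hP'' -
    ((-1) ^ k * (-1) ^ m * t * R * s * w * q ^ k * q ^ k * q ^ m * Q * c) * hb

/-- The coefficients are shifted by a simultaneous shift of degree, index and `N`. -/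
theorem qKrawCoeff_succ_succ {q : ℝ} (hq0 : 0 < q) (hq1 : q < 1) (n k : ℕ) (M : ℤ) :
    qKrawCoeff q (n + 1) (k + 1) (M + 1) * (1 - (q ^ (k + 1))⁻¹) =
      -(q ^ n * (1 - q ^ (n + 1)) * qKrawCoeff q n k M) := by
  have hq := hq0.ne'
  have hs := qPoch_self_ne_zero hq0 hq1 (k + 1)
  unfold qKrawCoeff
  rw [qPoch_succ_left q (q ^ (-((n + 1 : ℕ) : ℤ))), zpow_neg_succ_mul hq, pow_triangle_succ,
    Nat.add_sub_add_right,
    show ((k + 1 : ℕ) : ℤ) - (M + 1) = k - M by push_cast; ring]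
  rw [qPoch_succ, ← pow_succ'] at *
  have h1 := left_ne_zero_of_mul hs
  have h2 := right_ne_zero_of_mul hs
  rw [zpow_neg, zpow_natCast]
  have e : (q ^ (n + 1 + 1)) ^ (k + 1) = (q ^ (n + 1)) ^ k * q ^ k * q * q ^ (n + 1) := by
    ring
  rw [e]
  have e3 : 1 - (q ^ (k + 1))⁻¹ = -(1 - q ^ (k + 1)) * (q ^ (k + 1))⁻¹ := by
    field_simp
    ring
  have e4 : 1 - (q ^ (n + 1))⁻¹ = -(1 - q ^ (n + 1)) * (q ^ (n + 1))⁻¹ := by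
    field_simp
    ring
  rw [e3, e4]
  generalize 1 - q ^ (k + 1) = u at *
  generalize 1 - q ^ (n + 1) = v at *
  generalize (q ^ (n + 1)) ^ k = w at *
  field_simp
  ring

/-- Raising `N` while lowering the parameter `p`. -/
theorem qKraw_raise_param {q : ℝ} (hq : q ≠ 0) (n : ℕ) (x M : ℤ) (p : ℝ) :
    qKraw q (n + 1) x (M + 1) (q⁻¹ * p) =
      q⁻¹ * (1 - q ^ (n + 1)) * qKraw q n x M p +
        q ^ (-((n + 1 : ℕ) : ℤ)) * qKraw q (n + 1) x M p := by
  have h : qKraw q n x M p =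
      ∑ k ∈ Finset.range (n + 2), qKrawCoeff q n k M * (qPoch q (q ^ (-x)) k * p ^ k) := by
    rw [Finset.sum_range_succ, qKrawCoeff_succ_self hq, zero_mul, add_zero, qKraw_eq_sum]
  rw [h, qKraw_eq_sum, qKraw_eq_sum, Finset.mul_sum, Finset.mul_sum, ← Finset.sum_add_distrib]
  refine Finset.sum_congr rfl fun k hk => ?_
  rw [qKrawCoeff_contiguous hq (Nat.lt_succ_iff.1 (Finset.mem_range.1 hk)), mul_pow, inv_pow]
  field_simp

theorem qPoch_zpow_shift {q : ℝ} (hq : q ≠ 0) (x : ℤ) (k : ℕ) :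
    qPoch q (q ^ (-(x + 1))) (k + 1) =
      (q ^ (k + 1))⁻¹ * qPoch q (q ^ (-x)) (k + 1) +
        (1 - (q ^ (k + 1))⁻¹) * qPoch q (q ^ (-x)) k := by
  have h : q ^ (-(x + 1)) * q = q ^ (-x) := by
    rw [← zpow_add_one₀ hq]
    congr 1
    ring
  rw [qPoch_succ_left, h, qPoch_succ, ← h]
  field_simp
  ring

/-- Raising `x` and `N` simultaneously. -/
theorem qKraw_raise_var {q : ℝ} (hq0 : 0 < q) (hq1 : q < 1) (n : ℕ) (x M : ℤ) (p : ℝ) :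
    qKraw q (n + 1) (x + 1) (M + 1) p =
      q⁻¹ * (1 - p * q ^ (n + 1)) * (1 - q ^ (n + 1)) * qKraw q n x M p +
        q ^ (-((n + 1 : ℕ) : ℤ)) * qKraw q (n + 1) x M p := by
  have hq := hq0.ne'
  have hsum : qKraw q (n + 1) (x + 1) (M + 1) p =
      qKraw q (n + 1) x (M + 1) (q⁻¹ * p) - q ^ n * (1 - q ^ (n + 1)) * p * qKraw q n x M p := by
    rw [qKraw_eq_sum, qKraw_eq_sum, qKraw_eq_sum q n, Finset.sum_range_succ',
      Finset.sum_range_succ' _ (n + 1), Finset.mul_sum, add_sub_right_comm,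
      ← Finset.sum_sub_distrib]
    congr 1
    refine Finset.sum_congr rfl fun k _ => ?_
    have h := qKrawCoeff_succ_succ hq0 hq1 n k M
    rw [qPoch_zpow_shift hq, mul_pow, inv_pow]
    linear_combination (qPoch q (q ^ (-x)) k * p ^ (k + 1)) * h
  rw [hsum, qKraw_raise_param hq]
  field_simp
  ring

/-- Raising relation in the second variable index `x₂`
(with the convention that `K` with a negative degree index vanishes). -/
theorem raising_x2 (q : ℝ) (hq0 : 0 < q) (hq1 : q < 1)
    (N : ℕ) (hN : 1 ≤ N) (θ φ : ℝ) (hθ : θ ≠ 0) (hφ : φ ≠ 0)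
    (n₁ n₂ : ℕ) (hn : n₁ + n₂ ≤ N - 1) (x₁ x₂ : ℕ) (hx : x₁ + x₂ ≤ N - 1) :
    Kq q n₁ n₂ x₁ ((x₂ : ℤ) + 1) (Real.sqrt q * θ) φ N
    = q⁻¹ * (1 - q ^ n₁) * Kq q ((n₁ : ℤ) - 1) n₂ x₁ x₂ θ φ ((N : ℤ) - 1)
      + q ^ (-(n₁ : ℤ) - 1) * (1 - (φ ^ 2)⁻¹ * q ^ n₂) * (1 - q ^ n₂) *
        Kq q n₁ ((n₂ : ℤ) - 1) x₁ x₂ θ φ ((N : ℤ) - 1)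
      + q ^ (-((n₁ : ℤ) + n₂)) * Kq q n₁ n₂ x₁ x₂ θ φ ((N : ℤ) - 1) := by
  have hsq : ((Real.sqrt q * θ) ^ 2)⁻¹ = q⁻¹ * (θ ^ 2)⁻¹ := by
    rw [mul_pow, Real.sq_sqrt hq0.le, mul_inv]
  have hq := hq0.ne'
  have hfst : qKraw q n₁ x₁ (x₁ + x₂ + 1) (q⁻¹ * (θ ^ 2)⁻¹) =
      q⁻¹ * (1 - q ^ n₁) * qKraw q (n₁ - 1) x₁ (x₁ + x₂) (θ ^ 2)⁻¹ +
        q ^ (-(n₁ : ℤ)) * qKraw q n₁ x₁ (x₁ + x₂) (θ ^ 2)⁻¹ := by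
    cases n₁ with
    | zero => simp [qKraw, qPoch]
    | succ n => exact qKraw_raise_param hq n _ _ _
  have hsnd : qKraw q n₂ (x₁ + x₂ - n₁ + 1) (N - 1 - n₁ + 1) (φ ^ 2)⁻¹ =
      q⁻¹ * (1 - (φ ^ 2)⁻¹ * q ^ n₂) * (1 - q ^ n₂) *
          qKraw q (n₂ - 1) (x₁ + x₂ - n₁) (N - 1 - n₁) (φ ^ 2)⁻¹ +
        q ^ (-(n₂ : ℤ)) * qKraw q n₂ (x₁ + x₂ - n₁) (N - 1 - n₁) (φ ^ 2)⁻¹ := by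
    cases n₂ with
    | zero => simp [qKraw, qPoch]
    | succ n => exact qKraw_raise_var hq0 hq1 n _ _ _
  have hL : Kq q n₁ n₂ x₁ ((x₂ : ℤ) + 1) (Real.sqrt q * θ) φ N =
      qKraw q n₁ x₁ (x₁ + x₂ + 1) (q⁻¹ * (θ ^ 2)⁻¹) *
        qKraw q n₂ (x₁ + x₂ - n₁ + 1) (N - 1 - n₁ + 1) (φ ^ 2)⁻¹ := by
    simp only [Kq, Nat.cast_nonneg, and_self, if_true, Int.toNat_natCast, hsq]
    congr 2 <;> ring
  have h₁ : (1 - q ^ n₁) * Kq q ((n₁ : ℤ) - 1) n₂ x₁ x₂ θ φ ((N : ℤ) - 1) =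
      (1 - q ^ n₁) * (qKraw q (n₁ - 1) x₁ (x₁ + x₂) (θ ^ 2)⁻¹ *
        qKraw q n₂ (x₁ + x₂ - n₁ + 1) (N - 1 - n₁ + 1) (φ ^ 2)⁻¹) := by
    cases n₁ with
    | zero => simp
    | succ n =>
      simp only [Kq, Nat.cast_nonneg, Nat.cast_succ, add_sub_cancel_right, Nat.add_sub_cancel,
        and_self, if_true, Int.toNat_natCast]
      congr 3 <;> ring
  have h₂ : (1 - q ^ n₂) * Kq q n₁ ((n₂ : ℤ) - 1) x₁ x₂ θ φ ((N : ℤ) - 1) =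
      (1 - q ^ n₂) * (qKraw q n₁ x₁ (x₁ + x₂) (θ ^ 2)⁻¹ *
        qKraw q (n₂ - 1) (x₁ + x₂ - n₁) (N - 1 - n₁) (φ ^ 2)⁻¹) := by
    cases n₂ with
    | zero => simp
    | succ n => simp [Kq]
  have h₃ : Kq q n₁ n₂ x₁ x₂ θ φ ((N : ℤ) - 1) =
      qKraw q n₁ x₁ (x₁ + x₂) (θ ^ 2)⁻¹ *
        qKraw q n₂ (x₁ + x₂ - n₁) (N - 1 - n₁) (φ ^ 2)⁻¹ := by
    simp [Kq]
  rw [mul_assoc q⁻¹, h₁, mul_assoc _ (1 - q ^ n₂), h₂, h₃, hL, hfst, neg_add, zpow_add₀ hq,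
    zpow_sub_one₀ hq]
  linear_combination
    (q ^ (-(n₁ : ℤ)) * qKraw q n₁ x₁ (x₁ + x₂) (θ ^ 2)⁻¹) * hsnd
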